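/- Let S and R be associative rings with identity and let T be an (S,R)-bimodule that is Wakamatsu tilting, with finite projective dimension as a right R-module, and assume T is tensorly faithful as a right R-module. Then S, regarded as a left S-module, is isomorphic to a direct summand of a finite direct sum T^ℓ of copies of T for some positive integer ℓ; equivalently, there is a split short exact sequence 0 → V → T^ℓ → S → 0 of left S-modules. -/

import Mathlib

/-!
Common definitions for formalizing the Wakamatsu tilting conjecture paper.
All rings are associative with identity; right `R`-modules are treated as
left `Rᵐᵒᵖ`-modules.
-/

open CategoryTheory

universe u

/-- Vanishing of `Ext^n_S(X, Y)` for left `S`-modules. -/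
abbrev ExtVanish (S : Type u) [Ring S] (n : ℕ) (X Y : ModuleCat.{u} S) : Prop :=
  Subsingleton (((Ext ℤ (ModuleCat.{u} S) n).obj (Opposite.op X)).obj Y)

/-- `N ∈ add_S T`: `N` is a direct summand of a finite direct sum of copies of `T`. -/
def MemAdd (S : Type u) [Ring S] (T N : ModuleCat.{u} S) : Prop :=
  ∃ (k : ℕ) (M : ModuleCat.{u} S), Nonempty ((↥N × ↥M) ≃ₗ[S] (Fin k → ↥T))

/-- `N ∈ gen*_S(T)`: there is an exact sequence `⋯ → X_1 → X_0 → N → 0` with all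
`X_i ∈ add_S T` and `Ext^1_S(T, Ker f_i) = 0` for all `i ≥ 0`. -/
def MemGenStar (S : Type u) [Ring S] (T N : ModuleCat.{u} S) : Prop :=
  ∃ (X : ℕ → ModuleCat.{u} S) (f : ∀ i, ↥(X (i + 1)) →ₗ[S] ↥(X i)) (f0 : ↥(X 0) →ₗ[S] ↥N),
    (∀ i, MemAdd S T (X i)) ∧
    Function.Surjective f0 ∧
    Function.Exact (f 0) f0 ∧
    (∀ i, Function.Exact (f (i + 1)) (f i)) ∧
    ExtVanish S 1 T (ModuleCat.of S (LinearMap.ker f0)) ∧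
    (∀ i, ExtVanish S 1 T (ModuleCat.of S (LinearMap.ker (f i))))

/-- The projective dimension of the left `S`-module `M` is at most `n`: there is a projective
resolution `0 → P_n → ⋯ → P_0 → M → 0`. -/
def PdLE (S : Type u) [Ring S] (M : ModuleCat.{u} S) (n : ℕ) : Prop :=
  ∃ (P : ℕ → ModuleCat.{u} S) (d : ∀ i, ↥(P (i + 1)) →ₗ[S] ↥(P i)) (ε : ↥(P 0) →ₗ[S] ↥M),
    (∀ i, Module.Projective S ↥(P i)) ∧
    Function.Surjective ε ∧
    Function.Exact (d 0) ε ∧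
    (∀ i, Function.Exact (d (i + 1)) (d i)) ∧
    (∀ i, n < i → Subsingleton ↥(P i))

/-- The projective dimension of `M` equals `n`. -/
def PdEq (S : Type u) [Ring S] (M : ModuleCat.{u} S) (n : ℕ) : Prop :=
  PdLE S M n ∧ ∀ m, PdLE S M m → n ≤ m

/-- `N ∈ T^⊥`: `Ext^i_S(T, N) = 0` for all `i ≥ 1`. -/
def MemPerp (S : Type u) [Ring S] (T N : ModuleCat.{u} S) : Prop :=
  ∀ i, 1 ≤ i → ExtVanish S i T N

/-- `N ∈ X_T = T^⊥ ∩ gen*_S(T)`. -/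
def MemXT (S : Type u) [Ring S] (T N : ModuleCat.{u} S) : Prop :=
  MemPerp S T N ∧ MemGenStar S T N

/-- There is an exact sequence `0 → B → X_0 → ⋯ → X_n → 0` with all `X_i ∈ add_S T`. -/
def HasFiniteAddCoresolution (S : Type u) [Ring S] (T B : ModuleCat.{u} S) (n : ℕ) : Prop :=
  ∃ (X : ℕ → ModuleCat.{u} S) (g : ∀ i, ↥(X i) →ₗ[S] ↥(X (i + 1))) (g0 : ↥B →ₗ[S] ↥(X 0)),
    (∀ i, i ≤ n → MemAdd S T (X i)) ∧
    (∀ i, n < i → Subsingleton ↥(X i)) ∧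
    Function.Injective g0 ∧
    Function.Exact g0 (g 0) ∧
    (∀ i, Function.Exact (g i) (g (i + 1)))

/-- `T` is an `n`-tilting left `A`-module (Miyashita); applying this with `A = Rᵐᵒᵖ`
gives the notion for right `R`-modules. -/
def IsNTilting (A : Type u) [Ring A] (T : ModuleCat.{u} A) (n : ℕ) : Prop :=
  MemGenStar A (ModuleCat.of A A) T ∧
  PdLE A T n ∧
  (∀ i, 0 < i → ExtVanish A i T T) ∧
  HasFiniteAddCoresolution A T (ModuleCat.of A A) n

/-- `T` is a Wakamatsu tilting left `A`-module (Definition 2.2); applying this with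
`A = Rᵐᵒᵖ` gives the notion for right `R`-modules: `T ∈ gen*(A)`, `Ext^i_A(T,T) = 0` for
`i > 0`, and there is an exact sequence `0 → A → X_0 → X_1 → ⋯` with `X_i ∈ add T`
which stays exact after applying `Hom_A(-, T)`. -/
def IsWakamatsuTilting (A : Type u) [Ring A] (T : ModuleCat.{u} A) : Prop :=
  MemGenStar A (ModuleCat.of A A) T ∧
  (∀ i, 0 < i → ExtVanish A i T T) ∧
  ∃ (X : ℕ → ModuleCat.{u} A) (g : ∀ i, ↥(X i) →ₗ[A] ↥(X (i + 1))) (g0 : A →ₗ[A] ↥(X 0)),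
    (∀ i, MemAdd A T (X i)) ∧
    Function.Injective g0 ∧
    Function.Exact g0 (g 0) ∧
    (∀ i, Function.Exact (g i) (g (i + 1))) ∧
    Function.Surjective (fun h : ↥(X 0) →ₗ[A] ↥T => h.comp g0) ∧
    Function.Exact (fun h : ↥(X 1) →ₗ[A] ↥T => h.comp (g 0))
      (fun h : ↥(X 0) →ₗ[A] ↥T => h.comp g0) ∧
    (∀ i, Function.Exact (fun h : ↥(X (i + 2)) →ₗ[A] ↥T => h.comp (g (i + 1)))
      (fun h : ↥(X (i + 1)) →ₗ[A] ↥T => h.comp (g i)))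

/-- The subgroup of `T ⊗_ℤ M` generated by the balancing relations `(t·r) ⊗ m - t ⊗ (r·m)`;
the quotient of `T ⊗_ℤ M` by it is the balanced tensor product `T ⊗_R M`. -/
noncomputable def TensorRel (R : Type u) [Ring R] (T : Type u) [AddCommGroup T]
    [Module Rᵐᵒᵖ T] (M : Type u) [AddCommGroup M] [Module R M] :
    AddSubgroup (TensorProduct ℤ T M) :=
  AddSubgroup.closure
    {x | ∃ (t : T) (r : R) (m : M),
      x = (MulOpposite.op r • t) ⊗ₜ[ℤ] m - t ⊗ₜ[ℤ] (r • m)}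

/-- The right `R`-module `T` is tensorly faithful: `T ⊗_R M ≠ 0` for every nonzero left
`R`-module `M` (equivalently, the balancing relations do not exhaust `T ⊗_ℤ M`). -/
def TensorlyFaithful (R : Type u) [Ring R] (T : Type u) [AddCommGroup T]
    [Module Rᵐᵒᵖ T] : Prop :=
  ∀ (M : Type u) [AddCommGroup M] [Module R M], Nontrivial M → TensorRel R T M ≠ ⊤

/-- The natural ring homomorphism `Rᵐᵒᵖ →+* End(_S T)` induced by the right `R`-action;
it being bijective says exactly that `R → End(_S T)ᵒᵖ` is an isomorphism. -/
def rightEndNat (S R : Type u) [Ring S] [Ring R] (T : Type u) [AddCommGroup T] [Module S T]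
    [Module Rᵐᵒᵖ T] [SMulCommClass S Rᵐᵒᵖ T] : Rᵐᵒᵖ →+* Module.End S T :=
  haveI := SMulCommClass.symm S Rᵐᵒᵖ T
  Module.toModuleEnd S T

/-- The bimodule `T` is Wakamatsu tilting, i.e. a semidualizing `(S,R)`-bimodule
(Lemma 2.3(iii)). -/
def IsSemidualizing (S R : Type u) [Ring S] [Ring R] (T : Type u) [AddCommGroup T]
    [Module S T] [Module Rᵐᵒᵖ T] [SMulCommClass S Rᵐᵒᵖ T] : Prop :=
  MemGenStar Rᵐᵒᵖ (ModuleCat.of Rᵐᵒᵖ Rᵐᵒᵖ) (ModuleCat.of Rᵐᵒᵖ T) ∧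
  MemGenStar S (ModuleCat.of S S) (ModuleCat.of S T) ∧
  Function.Bijective (Module.toModuleEnd Rᵐᵒᵖ T : S →+* Module.End Rᵐᵒᵖ T) ∧
  Function.Bijective (rightEndNat S R T) ∧
  (∀ i, 0 < i → ExtVanish Rᵐᵒᵖ i (ModuleCat.of Rᵐᵒᵖ T) (ModuleCat.of Rᵐᵒᵖ T)) ∧
  (∀ i, 0 < i → ExtVanish S i (ModuleCat.of S T) (ModuleCat.of S T))

/-- The left `R`-module structure on `Hom_S(T, M)` given by `(r • f) t = f (t · r)`. -/
def homModule (S R : Type u) [Ring S] [Ring R] (T : Type u) [AddCommGroup T] [Module S T]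
    [Module Rᵐᵒᵖ T] [SMulCommClass S Rᵐᵒᵖ T] (M : Type u) [AddCommGroup M] [Module S M] :
    Module R (T →ₗ[S] M) where
  smul r f :=
    { toFun := fun t => f (MulOpposite.op r • t)
      map_add' := fun t₁ t₂ => by
        show f (MulOpposite.op r • (t₁ + t₂)) = _
        rw [smul_add, map_add]
      map_smul' := fun s t => by
        show f (MulOpposite.op r • (s • t)) = s • f (MulOpposite.op r • t)
        rw [← smul_comm s (MulOpposite.op r) t, map_smul] }
  one_smul f := by
    apply LinearMap.ext; intro t
    show f ((MulOpposite.op (1 : R)) • t) = f t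
    rw [MulOpposite.op_one, one_smul]
  mul_smul r₁ r₂ f := by
    apply LinearMap.ext; intro t
    show f ((MulOpposite.op (r₁ * r₂)) • t) = f (MulOpposite.op r₂ • MulOpposite.op r₁ • t)
    rw [MulOpposite.op_mul, mul_smul]
  smul_zero r := by apply LinearMap.ext; intro t; rfl
  smul_add r f g := by apply LinearMap.ext; intro t; rfl
  add_smul r₁ r₂ f := by
    apply LinearMap.ext; intro t
    show f ((MulOpposite.op (r₁ + r₂)) • t) = f (MulOpposite.op r₁ • t) + f (MulOpposite.op r₂ • t)
    rw [MulOpposite.op_add, add_smul, map_add]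
  zero_smul f := by
    apply LinearMap.ext; intro t
    show f ((MulOpposite.op (0 : R)) • t) = 0
    rw [MulOpposite.op_zero, zero_smul, map_zero]

/-- The evaluation map `T ⊗_ℤ Hom_S(T, M) → M`, `t ⊗ h ↦ h t`. -/
noncomputable def evalMap (S : Type u) [Ring S] (T : Type u) [AddCommGroup T] [Module S T]
    (M : Type u) [AddCommGroup M] [Module S M] :
    TensorProduct ℤ T (T →ₗ[S] M) →ₗ[ℤ] M :=
  TensorProduct.lift
    (LinearMap.mk₂ ℤ (fun t h => h t)
      (fun t₁ t₂ h => by show h (t₁ + t₂) = h t₁ + h t₂; rw [map_add])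
      (fun z t h => by show h (z • t) = z • h t; rw [map_zsmul])
      (fun t h₁ h₂ => rfl)
      (fun z t h => rfl))

/-- `Tor^R_i(T, N) = 0` for all `i ≥ 1`: for every projective resolution `P_•` of the left
`R`-module `N`, the induced complex `T ⊗_R P_•` is exact in positive degrees (expressed
via the presentation of `T ⊗_R -` as a quotient of `T ⊗_ℤ -` by the balancing relations). -/
def TorVanishPos (R : Type u) [Ring R] (T : Type u) [AddCommGroup T] [Module Rᵐᵒᵖ T]
    (N : Type u) [AddCommGroup N] [Module R N] : Prop :=
  ∀ (P : ℕ → ModuleCat.{u} R) (d : ∀ i, ↥(P (i + 1)) →ₗ[R] ↥(P i)) (ε : ↥(P 0) →ₗ[R] N),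
    (∀ i, Module.Projective R ↥(P i)) → Function.Surjective ε →
    Function.Exact (d 0) ε → (∀ i, Function.Exact (d (i + 1)) (d i)) →
    ∀ (i : ℕ) (x : TensorProduct ℤ T ↥(P (i + 1))),
      TensorProduct.map (LinearMap.id : T →ₗ[ℤ] T)
          ((d i).toAddMonoidHom.toIntLinearMap) x ∈ TensorRel R T ↥(P i) →
      ∃ y : TensorProduct ℤ T ↥(P (i + 2)),
        x - TensorProduct.map (LinearMap.id : T →ₗ[ℤ] T)
          ((d (i + 1)).toAddMonoidHom.toIntLinearMap) y ∈ TensorRel R T ↥(P (i + 1))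

/-- `M` belongs to the Bass class `B_T(S)`: the evaluation map
`T ⊗_R Hom_S(T, M) → M` is an isomorphism (it is surjective, and its kernel is exactly the
subgroup of balancing relations), `Ext^i_S(T, M) = 0` and `Tor^R_i(T, Hom_S(T, M)) = 0`
for all `i ≥ 1`. -/
def MemBass (S R : Type u) [Ring S] [Ring R] (T : Type u) [AddCommGroup T] [Module S T]
    [Module Rᵐᵒᵖ T] [SMulCommClass S Rᵐᵒᵖ T] (M : Type u) [AddCommGroup M] [Module S M] :
    Prop :=
  letI := homModule S R T M
  Function.Surjective (evalMap S T M) ∧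
  (∀ x, evalMap S T M x = 0 ↔ x ∈ TensorRel R T (T →ₗ[S] M)) ∧
  (∀ i, 1 ≤ i → ExtVanish S i (ModuleCat.of S T) (ModuleCat.of S M)) ∧
  TorVanishPos R T (T →ₗ[S] M)

/-- `R` is a left max ring: every nonzero left `R`-module has a maximal (proper) submodule. -/
def IsLeftMaxRing (R : Type u) [Ring R] : Prop :=
  ∀ (M : Type u) [AddCommGroup M] [Module R M], Nontrivial M → ∃ N : Submodule R M, IsCoatom N

/-- `R` is left Kasch: every simple quotient `R/n` by a maximal left ideal embeds as a
left ideal of `R`. -/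
def IsLeftKasch (R : Type u) [Ring R] : Prop :=
  ∀ n : Submodule R R, IsCoatom n → ∃ I : Submodule R R, Nonempty ((R ⧸ n) ≃ₗ[R] ↥I)


section Extension

variable {A : Type u} [Ring A]

/-- An exact sequence of projective modules augmented onto `M`, as a projective resolution. -/
lemma exists_projectiveResolution {M : ModuleCat.{u} A} (P : ℕ → ModuleCat.{u} A)
    (d : ∀ i, P (i + 1) →ₗ[A] P i) (ε : P 0 →ₗ[A] M)
    (hP : ∀ i, Module.Projective A (P i)) (hε : Function.Surjective ε)
    (h0 : Function.Exact (d 0) ε) (hd : ∀ i, Function.Exact (d (i + 1)) (d i)) :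
    ∃ sq : ∀ n, ModuleCat.ofHom (d (n + 1)) ≫ ModuleCat.ofHom (d n) = 0,
      ∃ Q : ProjectiveResolution M,
        Q.complex = ChainComplex.of P (fun i => ModuleCat.ofHom (d i)) sq := by
  have sq : ∀ n, ModuleCat.ofHom (d (n + 1)) ≫ ModuleCat.ofHom (d n) = 0 := fun n => by
    ext x
    exact (hd n).apply_apply_eq_zero x
  have hdε : ModuleCat.ofHom (d 0) ≫ ModuleCat.ofHom ε = 0 := by
    ext x
    exact h0.apply_apply_eq_zero x
  refine ⟨sq, ⟨⟨ChainComplex.of P (fun i => ModuleCat.ofHom (d i)) sq, fun n => ?_,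
    (ChainComplex.toSingle₀Equiv _ _).symm ⟨ModuleCat.ofHom ε, ?_⟩, ⟨fun n => ?_⟩⟩, rfl⟩⟩
  · exact (IsProjective.iff_projective (P n)).1 (hP n)
  · exact (congrArg (· ≫ ModuleCat.ofHom ε) (ChainComplex.of_d P _ 0)).trans hdε
  · cases n
    · rw [ChainComplex.quasiIsoAt₀_iff, ShortComplex.quasiIso_iff_of_zeros']
      · refine (ShortComplex.exact_and_epi_g_iff_of_iso (S₂ := ShortComplex.mk _ _ hdε) ?_).2
          ⟨ModuleCat.shortComplex_exact _ h0, (ModuleCat.epi_iff_surjective _).2 hε⟩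
        exact ShortComplex.isoMk (Iso.refl _) (Iso.refl _) (Iso.refl _)
          ((Category.id_comp _).trans
            ((ChainComplex.of_d P (fun i => ModuleCat.ofHom (d i)) 0).symm.trans
              (Category.comp_id _).symm))
          ((Category.id_comp _).trans
            ((ChainComplex.toSingle₀Equiv_symm_apply_f_zero
              (C := ChainComplex.of P (fun i => ModuleCat.ofHom (d i)) sq) (X := M)
              (ModuleCat.ofHom ε) _).symm.trans
              (Category.comp_id _).symm))
      all_goals rfl
    · rename_i n
      rw [quasiIsoAt_iff_exactAt' _ _ (ChainComplex.exactAt_succ_single_obj _ _),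
        HomologicalComplex.exactAt_iff' _ (n + 1 + 1) (n + 1) n (by simp) (by simp)]
      refine ModuleCat.shortComplex_exact _ ?_
      simp only [HomologicalComplex.sc', HomologicalComplex.shortComplexFunctor',
        ChainComplex.of_d]
      exact hd n

/-- Vanishing of `Ext` lets cocycles on a projective resolution be extended. -/
lemma exists_comp_eq_of_extVanish {M N : ModuleCat.{u} A} (P : ℕ → ModuleCat.{u} A)
    (d : ∀ i, P (i + 1) →ₗ[A] P i) (ε : P 0 →ₗ[A] M)
    (hP : ∀ i, Module.Projective A (P i)) (hε : Function.Surjective ε)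
    (h0 : Function.Exact (d 0) ε) (hd : ∀ i, Function.Exact (d (i + 1)) (d i)) (i : ℕ)
    (hext : ExtVanish A (i + 1) M N) (h : P (i + 1) →ₗ[A] N) (hh : h ∘ₗ d (i + 1) = 0) :
    ∃ g : P i →ₗ[A] N, g ∘ₗ d i = h := by
  obtain ⟨sq, Q, hQ⟩ := exists_projectiveResolution P d ε hP hε h0 hd
  have hz : Limits.IsZero ((Q.complex.linearYonedaObj ℤ N).homology (i + 1)) :=
    Limits.IsZero.of_iso (@ModuleCat.isZero_of_subsingleton _ _ _ hext) (Q.isoExt (i + 1) N).symm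
  rw [hQ, ← HomologicalComplex.exactAt_iff_isZero_homology,
    HomologicalComplex.exactAt_iff' _ i (i + 1) (i + 1 + 1) (by simp) (by simp),
    ShortComplex.moduleCat_exact_iff] at hz
  obtain ⟨g, hg⟩ := hz (ModuleCat.ofHom h) (by
    have hzero : ModuleCat.ofHom (d (i + 1)) ≫ ModuleCat.ofHom h = 0 :=
      congrArg ModuleCat.ofHom hh
    exact (congrArg (· ≫ ModuleCat.ofHom h) (ChainComplex.of_d P
      (fun i => ModuleCat.ofHom (d i)) (i + 1))).trans hzero)
  refine ⟨ModuleCat.Hom.hom g, ?_⟩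
  have := (congrArg (· ≫ g) (ChainComplex.of_d P (fun i => ModuleCat.ofHom (d i)) i)).symm.trans hg
  exact congrArg ModuleCat.Hom.hom this

end Extension

section Syzygy

variable {A : Type u} [Ring A] {M : ModuleCat.{u} A} (P : ℕ → ModuleCat.{u} A)
  (d : ∀ i, P (i + 1) →ₗ[A] P i) (ε : P 0 →ₗ[A] M)

/-- The syzygies of an augmented sequence. -/
def syzygy : ∀ i, Submodule A (P i)
  | 0 => LinearMap.ker ε
  | i + 1 => LinearMap.ker (d i)

variable {P d ε}

lemma range_eq_syzygy (h0 : Function.Exact (d 0) ε)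
    (hd : ∀ i, Function.Exact (d (i + 1)) (d i)) (i : ℕ) :
    LinearMap.range (d i) = syzygy P d ε i := by
  cases i with
  | zero => exact h0.linearMap_ker_eq.symm
  | succ i => exact (hd i).linearMap_ker_eq.symm

lemma exists_surjective_syzygy (h0 : Function.Exact (d 0) ε)
    (hd : ∀ i, Function.Exact (d (i + 1)) (d i)) (i : ℕ) :
    ∃ p : P (i + 1) →ₗ[A] syzygy P d ε i, Function.Surjective p ∧
      (syzygy P d ε i).subtype ∘ₗ p = d i ∧ LinearMap.ker p = syzygy P d ε (i + 1) := by
  have hr := range_eq_syzygy h0 hd i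
  refine ⟨(d i).codRestrict _ fun x => hr ▸ LinearMap.mem_range_self _ x, ?_, ?_, ?_⟩
  · rintro ⟨y, hy⟩
    rw [← hr] at hy
    obtain ⟨x, rfl⟩ := hy
    exact ⟨x, rfl⟩
  · exact LinearMap.subtype_comp_codRestrict _ _ _
  · exact LinearMap.ker_codRestrict _ _ _

lemma hasProjectiveDimensionLT_ker_iff {X N : Type u} [AddCommGroup X] [Module A X]
    [AddCommGroup N] [Module A N] [hX : Module.Projective A X] (p : X →ₗ[A] N)
    (hp : Function.Surjective p) (n : ℕ) :
    HasProjectiveDimensionLT (ModuleCat.of A N) (n + 2) ↔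
      HasProjectiveDimensionLT (ModuleCat.of A (LinearMap.ker p)) (n + 1) :=
  (LinearMap.shortExact_shortComplexKer hp).hasProjectiveDimensionLT_X₃_iff n
    ((IsProjective.iff_projective X).1 hX)

lemma hasProjectiveDimensionLT_syzygy_iff (hP : ∀ i, Module.Projective A (P i))
    (hε : Function.Surjective ε) (h0 : Function.Exact (d 0) ε)
    (hd : ∀ i, Function.Exact (d (i + 1)) (d i)) (i n : ℕ) :
    HasProjectiveDimensionLT M (i + n + 2) ↔
      HasProjectiveDimensionLT (ModuleCat.of A (syzygy P d ε i)) (n + 1) := by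
  induction i generalizing n with
  | zero =>
    rw [Nat.zero_add]
    have := hP 0
    exact hasProjectiveDimensionLT_ker_iff ε hε n
  | succ i ih =>
    obtain ⟨p, hp, -, hker⟩ := exists_surjective_syzygy (ε := ε) h0 hd i
    have := hP (i + 1)
    rw [← hker, ← hasProjectiveDimensionLT_ker_iff p hp, ← ih (n + 1)]
    rw [show i + 1 + n + 2 = i + (n + 1) + 2 by omega]

/-- A module of projective dimension at most `n` has a projective `n`-th syzygy in every
projective resolution. -/
lemma projective_syzygy_of_pdLE {n : ℕ} (hM : PdLE A M n) (hP : ∀ i, Module.Projective A (P i))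
    (hε : Function.Surjective ε) (h0 : Function.Exact (d 0) ε)
    (hd : ∀ i, Function.Exact (d (i + 1)) (d i)) :
    Module.Projective A (syzygy P d ε n) := by
  obtain ⟨P', d', ε', hP', hε', h0', hd', hsub⟩ := hM
  have : Subsingleton (syzygy P' d' ε' n) := by
    obtain ⟨p, hp, -⟩ := exists_surjective_syzygy (ε := ε') h0' hd' n
    have := hsub (n + 1) n.lt_succ_self
    exact hp.subsingleton
  have hpd : HasProjectiveDimensionLT M (n + 0 + 2) := by
    rw [hasProjectiveDimensionLT_syzygy_iff hP' hε' h0' hd' n 0]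
    have := (IsProjective.iff_projective (R := A) (syzygy P' d' ε' n)).1 inferInstance
    infer_instance
  rw [hasProjectiveDimensionLT_syzygy_iff hP hε h0 hd n 0] at hpd
  exact (IsProjective.iff_projective _).2 inferInstance

end Syzygy

lemma MemAdd.finite_projective {A : Type u} [Ring A] {N : ModuleCat.{u} A}
    (hN : MemAdd A (ModuleCat.of A A) N) : Module.Finite A N ∧ Module.Projective A N := by
  obtain ⟨k, M, ⟨e⟩⟩ := hN
  let e' : (N × M) ≃ₗ[A] (Fin k → A) := e
  have hs : (LinearMap.fst A N M ∘ₗ e'.symm.toLinearMap) ∘ₗ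
      (e'.toLinearMap ∘ₗ LinearMap.inl A N M) = LinearMap.id := by
    ext x; simp
  exact ⟨.of_surjective (LinearMap.fst A N M ∘ₗ e'.symm.toLinearMap)
    (Function.RightInverse.surjective (LinearMap.congr_fun hs)), .of_split _ _ hs⟩

lemma Module.Projective.of_surjective_of_retraction {A X N : Type*} [Ring A] [AddCommGroup X]
    [Module A X] [AddCommGroup N] [Module A N] [Module.Projective A X] (p : X →ₗ[A] N)
    (hp : Function.Surjective p) {K : Submodule A X} (hK : LinearMap.ker p = K) (r : X →ₗ[A] K)
    (hr : r ∘ₗ K.subtype = LinearMap.id) : Module.Projective A N := by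
  subst hK
  have hexact : Function.Exact (LinearMap.ker p).subtype p := p.exact_subtype_ker_map
  obtain ⟨e, -, he⟩ := hexact.splitInjectiveEquiv hp ⟨r, hr⟩
  exact .of_split (e.symm.toLinearMap ∘ₗ LinearMap.inr A _ N) p (by ext; simp [he])

section DualBasis

variable {R : Type u} [Ring R]

lemma exists_dual_basis (K : Type*) [AddCommGroup K] [Module Rᵐᵒᵖ K] [Module.Finite Rᵐᵒᵖ K]
    [Module.Projective Rᵐᵒᵖ K] :
    ∃ (n : ℕ) (x : Fin n → K) (ξ : Fin n → K →ₗ[Rᵐᵒᵖ] R),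
      ∀ p, ∑ k, MulOpposite.op (ξ k p) • x k = p := by
  obtain ⟨n, f, g, -, -, hfg⟩ := Module.Finite.exists_comp_eq_id_of_projective Rᵐᵒᵖ K
  let u : Rᵐᵒᵖ →ₗ[Rᵐᵒᵖ] R :=
    { toFun := MulOpposite.unop
      map_add' := fun _ _ => rfl
      map_smul' := fun _ _ => rfl }
  refine ⟨n, fun k => f (Pi.single k 1), fun k => u ∘ₗ LinearMap.proj k ∘ₗ g, fun p => ?_⟩
  conv_rhs => rw [← LinearMap.id_apply (R := Rᵐᵒᵖ) p, ← hfg, LinearMap.comp_apply,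
    pi_eq_sum_univ' (g p), map_sum]
  refine Finset.sum_congr rfl fun k _ => ?_
  rw [← map_smul]
  congr 1

variable {T : Type u} [AddCommGroup T] [Module Rᵐᵒᵖ T]

variable (R) in
/-- The image of `t ⊗ m` in the balanced tensor product. -/
noncomputable def balancedTmul (M : Type u) [AddCommGroup M] [Module R M] :
    T →+ M →+ TensorProduct ℤ T M ⧸ TensorRel R T M :=
  AddMonoidHom.mk' (fun t => (QuotientAddGroup.mk' (TensorRel R T M)).comp
      (TensorProduct.mk ℤ T M t).toAddMonoidHom) fun t t' => by
    ext m
    exact congrArg (QuotientAddGroup.mk' (TensorRel R T M)) (TensorProduct.add_tmul t t' m)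

lemma balancedTmul_smul (M : Type u) [AddCommGroup M] [Module R M] (t : T) (r : R) (m : M) :
    balancedTmul R M t (r • m) = balancedTmul R M (MulOpposite.op r • t) m := by
  refine (QuotientAddGroup.eq_iff_sub_mem.2 ?_).symm
  exact AddSubgroup.subset_closure ⟨t, r, m, rfl⟩

lemma tensorRel_eq_top (M : Type u) [AddCommGroup M] [Module R M]
    (h : ∀ (t : T) (m : M), balancedTmul R M t m = 0) : TensorRel R T M = ⊤ := by
  refine eq_top_iff.2 fun x _ => ?_
  induction x using TensorProduct.induction_on with
  | zero => exact zero_mem _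
  | tmul t m => exact (QuotientAddGroup.eq_zero_iff _).1 (h t m)
  | add x y hx hy => exact add_mem (hx trivial) (hy trivial)

/-- If every map from a submodule `K` to a tensorly faithful module extends to the ambient module,
and both modules are finitely generated projective, then `K` is a direct summand. -/
lemma TensorlyFaithful.exists_retraction (hT : TensorlyFaithful R T) {X : Type u} [AddCommGroup X]
    [Module Rᵐᵒᵖ X] [Module.Finite Rᵐᵒᵖ X] [Module.Projective Rᵐᵒᵖ X] (K : Submodule Rᵐᵒᵖ X)
    [Module.Finite Rᵐᵒᵖ K] [Module.Projective Rᵐᵒᵖ K]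
    (hK : ∀ h : K →ₗ[Rᵐᵒᵖ] T, ∃ g : X →ₗ[Rᵐᵒᵖ] T, g ∘ₗ K.subtype = h) :
    ∃ r : X →ₗ[Rᵐᵒᵖ] K, r ∘ₗ K.subtype = LinearMap.id := by
  obtain ⟨n, x, ξ, hξ⟩ := exists_dual_basis (R := R) K
  obtain ⟨m, y, ψ, hψ⟩ := exists_dual_basis (R := R) X
  let E : Submodule R (K →ₗ[Rᵐᵒᵖ] R) :=
    { carrier := {φ | ∃ χ : X →ₗ[Rᵐᵒᵖ] R, χ ∘ₗ K.subtype = φ}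
      add_mem' := by
        rintro _ _ ⟨a, rfl⟩ ⟨b, rfl⟩
        exact ⟨a + b, rfl⟩
      zero_mem' := ⟨0, rfl⟩
      smul_mem' := by
        rintro r _ ⟨a, rfl⟩
        exact ⟨r • a, rfl⟩ }
  have expand (φ : K →ₗ[Rᵐᵒᵖ] R) : φ = ∑ k, φ (x k) • ξ k := by
    ext p
    conv_lhs => rw [← hξ p, map_sum]
    rw [LinearMap.sum_apply]
    exact Finset.sum_congr rfl fun k _ => map_smul φ _ _
  have key (t : T) (q : (K →ₗ[Rᵐᵒᵖ] R) ⧸ E) : balancedTmul R _ t q = 0 := by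
    obtain ⟨φ, rfl⟩ := E.mkQ_surjective q
    let h : K →ₗ[Rᵐᵒᵖ] T :=
      { toFun := fun p => MulOpposite.op (φ p) • t
        map_add' := fun p q => by rw [map_add, MulOpposite.op_add, add_smul]
        map_smul' := fun a p => by
          rw [map_smul, RingHom.id_apply, smul_smul]
          rfl }
    obtain ⟨g, hg⟩ := hK h
    have hx (k) : MulOpposite.op (φ (x k)) • t = ∑ j, MulOpposite.op (ψ j (x k)) • g (y j) := by
      have : h (x k) = g (x k) := by rw [← hg]; rfl
      refine this.trans ?_
      conv_lhs => rw [← hψ (x k), map_sum]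
      simp only [map_smul]
    calc balancedTmul R _ t (E.mkQ φ)
        = ∑ k, balancedTmul R _ (MulOpposite.op (φ (x k)) • t) (E.mkQ (ξ k)) := by
          conv_lhs => rw [expand φ]
          simp only [map_sum, map_smul, balancedTmul_smul]
      _ = ∑ j, balancedTmul R _ (g (y j)) (E.mkQ (∑ k, ψ j (x k) • ξ k)) := by
          simp only [hx, map_sum, map_smul, balancedTmul_smul, AddMonoidHom.finsetSum_apply]
          exact Finset.sum_comm
      _ = 0 := by
          refine Finset.sum_eq_zero fun j _ => ?_
          have := expand (ψ j ∘ₗ K.subtype)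
          have hmem : (∑ k, ψ j (x k) • ξ k) ∈ E := ⟨ψ j, this⟩
          rw [Submodule.mkQ_apply, (Submodule.Quotient.mk_eq_zero E).2 hmem, map_zero]
  have htop (φ : K →ₗ[Rᵐᵒᵖ] R) : φ ∈ E := by
    by_contra hφ
    refine hT ((K →ₗ[Rᵐᵒᵖ] R) ⧸ E) ⟨E.mkQ φ, 0, fun h0 => hφ ?_⟩ (tensorRel_eq_top _ key)
    exact (Submodule.Quotient.mk_eq_zero E).1 h0
  choose χ hχ using fun k => htop (ξ k)
  refine ⟨∑ k,
    { toFun := fun p => MulOpposite.op (χ k p) • x k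
      map_add' := fun p q => by rw [map_add, MulOpposite.op_add, add_smul]
      map_smul' := fun a p => by
        rw [map_smul, RingHom.id_apply, smul_smul]
        rfl }, ?_⟩
  ext p : 1
  rw [LinearMap.comp_apply, LinearMap.sum_apply, LinearMap.id_apply]
  conv_rhs => rw [← hξ p]
  refine Finset.sum_congr rfl fun k _ => ?_
  rw [← hχ k]
  rfl

/-- A tensorly faithful right module without self-extensions that has a resolution by finitely
generated projectives and finite projective dimension is finitely generated projective. -/
lemma TensorlyFaithful.finite_projective (hT : TensorlyFaithful R T)
    (hgen : MemGenStar Rᵐᵒᵖ (ModuleCat.of Rᵐᵒᵖ Rᵐᵒᵖ) (ModuleCat.of Rᵐᵒᵖ T))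
    (hext : ∀ i, 0 < i → ExtVanish Rᵐᵒᵖ i (ModuleCat.of Rᵐᵒᵖ T) (ModuleCat.of Rᵐᵒᵖ T))
    (hpd : ∃ n : ℕ, PdLE Rᵐᵒᵖ (ModuleCat.of Rᵐᵒᵖ T) n) :
    Module.Finite Rᵐᵒᵖ T ∧ Module.Projective Rᵐᵒᵖ T := by
  obtain ⟨P, d, ε, hadd, hε, h0, hd, -⟩ := hgen
  obtain ⟨n, hn⟩ := hpd
  have hfin i : Module.Finite Rᵐᵒᵖ (P i) := (hadd i).finite_projective.1
  have hP i : Module.Projective Rᵐᵒᵖ (P i) := (hadd i).finite_projective.2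
  have hKfin i : Module.Finite Rᵐᵒᵖ (syzygy P d ε i) := by
    obtain ⟨p, hp, -⟩ := exists_surjective_syzygy (ε := ε) h0 hd i
    exact .of_surjective p hp
  have retract i (_ : Module.Projective Rᵐᵒᵖ (syzygy P d ε i)) :
      ∃ r : P i →ₗ[Rᵐᵒᵖ] syzygy P d ε i, r ∘ₗ (syzygy P d ε i).subtype = LinearMap.id := by
    refine hT.exists_retraction _ fun h => ?_
    obtain ⟨p, hp, hpd, hker⟩ := exists_surjective_syzygy (ε := ε) h0 hd i
    obtain ⟨g, hg⟩ := exists_comp_eq_of_extVanish P d ε hP hε h0 hd i (hext _ i.succ_pos)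
      (h ∘ₗ p) (by
        ext z
        have hz : d (i + 1) z ∈ LinearMap.ker p := by
          rw [hker]
          exact (hd i).apply_apply_eq_zero z
        rw [LinearMap.comp_apply, LinearMap.comp_apply, LinearMap.mem_ker.1 hz, map_zero]
        rfl)
    refine ⟨g, LinearMap.ext fun z => ?_⟩
    obtain ⟨w, rfl⟩ := hp z
    rw [← LinearMap.comp_apply h p, ← hg, ← hpd]
    rfl
  have hproj : Module.Projective Rᵐᵒᵖ (syzygy P d ε 0) := by
    have hlast := projective_syzygy_of_pdLE hn hP hε h0 hd
    clear hn
    induction n with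
    | zero => exact hlast
    | succ n ih =>
      refine ih ?_
      obtain ⟨p, hp, -, hker⟩ := exists_surjective_syzygy (ε := ε) h0 hd n
      obtain ⟨r, hr⟩ := retract (n + 1) hlast
      exact .of_surjective_of_retraction p hp hker r hr
  obtain ⟨r, hr⟩ := retract 0 hproj
  exact ⟨.of_surjective ε hε, .of_surjective_of_retraction ε hε rfl r hr⟩

end DualBasis

/-- part of the proof of Theorem 2.10. Let `T` be a Wakamatsu tilting
(semidualizing) `(S,R)`-bimodule of finite projective dimension as a right `R`-module which
is tensorly faithful. Then `S` is a direct summand of `T^ℓ` as a left `S`-module for some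
`ℓ > 0`. -/
theorem regular_module_summand_of_finite_copies
    (S R : Type u) [Ring S] [Ring R] (T : Type u) [AddCommGroup T] [Module S T]
    [Module Rᵐᵒᵖ T] [SMulCommClass S Rᵐᵒᵖ T]
    (hsd : IsSemidualizing S R T)
    (hpd : ∃ n : ℕ, PdLE Rᵐᵒᵖ (ModuleCat.of Rᵐᵒᵖ T) n)
    (hfaith : TensorlyFaithful R T) :
    ∃ ℓ : ℕ, 0 < ℓ ∧ ∃ V : ModuleCat.{u} S,
      Nonempty ((S × ↥V) ≃ₗ[S] (Fin ℓ → T)) := by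
  obtain ⟨hgen, -, hend, -, hext, -⟩ := hsd
  obtain ⟨_, _⟩ := hfaith.finite_projective hgen hext hpd
  obtain ⟨n, x, ξ, hξ⟩ := exists_dual_basis (R := R) T
  -- `ρ` sends a family `t` to the element of `S` acting as `y ↦ ∑ k, t k · ξ k y`.
  let endo (t : Fin n → T) : Module.End Rᵐᵒᵖ T := ∑ k,
    { toFun := fun y => MulOpposite.op (ξ k y) • t k
      map_add' := fun y z => by rw [map_add, MulOpposite.op_add, add_smul]
      map_smul' := fun a y => by
        rw [map_smul, RingHom.id_apply, smul_smul]
        rfl }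
  have endo_apply (t y) : endo t y = ∑ k, MulOpposite.op (ξ k y) • t k :=
    LinearMap.sum_apply _ _ _
  choose ρ hρ using fun t => hend.2 (endo t)
  have hρ' (t y) : ρ t • y = ∑ k, MulOpposite.op (ξ k y) • t k := by
    rw [← endo_apply, ← hρ]
    rfl
  have ext_S {s s' : S} (h : ∀ y : T, s • y = s' • y) : s = s' :=
    hend.1 (LinearMap.ext h)
  let ρl : (Fin n → T) →ₗ[S] S :=
    { toFun := ρ
      map_add' := fun t t' => ext_S fun y => by
        simp only [add_smul, hρ', Pi.add_apply, smul_add, Finset.sum_add_distrib]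
      map_smul' := fun s t => ext_S fun y => by
        simp only [RingHom.id_apply, smul_eq_mul, mul_smul, hρ', Pi.smul_apply, Finset.smul_sum]
        exact Finset.sum_congr rfl fun k _ => (smul_comm s _ _).symm }
  have hρx : ρl x = 1 := ext_S fun y => by
    rw [one_smul]
    exact (hρ' x y).trans (hξ y)
  have hρsurj : Function.Surjective ρl := fun s =>
    ⟨s • x, by rw [map_smul, hρx, smul_eq_mul, mul_one]⟩
  let p : (Fin (n + 1) → T) →ₗ[S] S := ρl ∘ₗ LinearMap.funLeft S T Fin.succ
  have hp : Function.Surjective p :=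
    hρsurj.comp (LinearMap.funLeft_surjective_of_injective S T _ (Fin.succ_injective n))
  obtain ⟨l, hl⟩ := p.exists_rightInverse_of_surjective (LinearMap.range_eq_top.2 hp)
  have hexact : Function.Exact (LinearMap.ker p).subtype p := p.exact_subtype_ker_map
  exact ⟨n + 1, n.succ_pos, ModuleCat.of S (LinearMap.ker p),
    ⟨LinearEquiv.prodComm S _ _ ≪≫ₗ
      (hexact.splitSurjectiveEquiv (Submodule.injective_subtype _) ⟨l, hl⟩).1.symm⟩⟩
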